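/- Let S = {S_i}_{i∈E} be a rotation-free similarity IFS on ℝ^d satisfying the strong open set condition with open set O, with attractor C of similarity dimension s and μ = H^s(C)^{-1}·H^s⌊C, and let k(x,y) = Ω(x−y)/|x−y|^s be an s-homogeneous kernel. Let w ∈ E^* be a finite word whose fixed point x_w of S_w lies in O, and let X = closure(O). Then there exist n₀ ∈ ℕ and c₁ > 0, depending only on S, Ω and w, such that for all v ∈ E^ℕ, all n ≥ 0 and all m ≥ 1 with σ^n(v) ∈ [w^{m+n₀}], one has |∫_{C_{v|_n}∖C_{v|_{n+m|w|}}} k(π(v),y) dμ(y) − ∫_{B₁∖B₂} k(π(v),y) dμ(y)| ≤ c₁, where B₁ = B(π(v), 2 diam(C_{v|_n})) and B₂ = B(π(v), 2 diam(C_{v|_{n+m|w|}})). -/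

import Mathlib

open MeasureTheory Metric Set Filter
open scoped ENNReal Topology NNReal

noncomputable section

/-- Euclidean space `ℝ^d`. -/
abbrev Euc (d : ℕ) := EuclideanSpace ℝ (Fin d)

/-- Composition `S_w = S_{w_1} ∘ ⋯ ∘ S_{w_n}` along a finite word. -/
def Sw {d N : ℕ} (S : Fin N → Euc d → Euc d) : List (Fin N) → Euc d → Euc d
  | [] => id
  | i :: t => S i ∘ Sw S t

/-- The finite word `w|_k = w_1 ⋯ w_k` of an infinite word. -/
def word {N : ℕ} (w : ℕ → Fin N) (k : ℕ) : List (Fin N) :=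
  List.ofFn (fun j : Fin k => w j)

/-- Distance between two sets. -/
def setDist {X : Type*} [PseudoMetricSpace X] (A B : Set X) : ℝ :=
  sInf (Set.image2 dist A B)

/-- The word `w` repeated `m` times. -/
def wrep {N : ℕ} (w : List (Fin N)) (m : ℕ) : List (Fin N) :=
  (List.replicate m w).flatten

/-- The unit vector `(x - ξ)/|x - ξ|`, as a point of the unit sphere. -/
def sphN {d : ℕ} (ξ x : Euc d) (h : x ≠ ξ) : sphere (0 : Euc d) 1 :=
  ⟨‖x - ξ‖⁻¹ • (x - ξ), by
    have hx : x - ξ ≠ 0 := sub_ne_zero.mpr h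
    simp [mem_sphere_iff_norm, norm_smul, abs_of_nonneg,
      inv_mul_cancel₀ (norm_ne_zero_iff.mpr hx)]⟩

/-- The starred integral: the integral if the integrand is integrable on the set, else `0`. -/
def starInt {X : Type*} [MeasurableSpace X] (μ : Measure X) (A : Set X) (g : X → ℝ) : ℝ :=
  @ite _ (IntegrableOn g A μ) (Classical.dec _) (∫ y in A, g y ∂μ) 0

section SelfSimilar

variable {d N : ℕ} {q : Fin N → Euc d} {r : Fin N → ℝ} {S : Fin N → Euc d → Euc d}

/-- The contraction ratio of `Sw S t`. -/
def wordRatio (r : Fin N → ℝ) (t : List (Fin N)) : ℝ := (t.map r).prod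

theorem wordRatio_pos (hr : ∀ i, r i ∈ Set.Ioo (0 : ℝ) 1) (t : List (Fin N)) :
    0 < wordRatio r t := by
  induction t with
  | nil => simp [wordRatio]
  | cons i t ih => simpa [wordRatio] using mul_pos (hr i).1 ih

theorem exists_ratio_bound (hr : ∀ i, r i ∈ Set.Ioo (0 : ℝ) 1) :
    ∃ ρ ∈ Set.Ico (0 : ℝ) 1, ∀ t : List (Fin N), wordRatio r t ≤ ρ ^ t.length := by
  obtain ⟨ρ, hρ, h⟩ : ∃ ρ ∈ Set.Ico (0 : ℝ) 1, ∀ i, r i ≤ ρ := by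
    rcases isEmpty_or_nonempty (Fin N) with _ | _
    · exact ⟨0, by simp, fun i => isEmptyElim i⟩
    · obtain ⟨j, hj⟩ := Finite.exists_max r
      exact ⟨r j, ⟨(hr j).1.le, (hr j).2⟩, hj⟩
  refine ⟨ρ, hρ, fun t => ?_⟩
  induction t with
  | nil => simp [wordRatio]
  | cons i t ih =>
    simp only [wordRatio, List.map_cons, List.prod_cons, List.length_cons, pow_succ'] at ih ⊢
    exact mul_le_mul (h i) ih (wordRatio_pos hr t).le hρ.1

theorem Sw_sub_Sw (hS : ∀ i x, S i x = q i + r i • x) (t : List (Fin N)) (x y : Euc d) :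
    Sw S t x - Sw S t y = wordRatio r t • (x - y) := by
  induction t with
  | nil => simp [Sw, wordRatio]
  | cons i t ih =>
    simp only [Sw, Function.comp_apply, hS, wordRatio, List.map_cons, List.prod_cons] at ih ⊢
    rw [add_sub_add_left_eq_sub, ← smul_sub, ih, mul_smul]

theorem dist_Sw (hr : ∀ i, r i ∈ Set.Ioo (0 : ℝ) 1) (hS : ∀ i x, S i x = q i + r i • x)
    (t : List (Fin N)) (x y : Euc d) :
    dist (Sw S t x) (Sw S t y) = wordRatio r t * dist x y := by
  rw [dist_eq_norm, Sw_sub_Sw hS, norm_smul, Real.norm_of_nonneg (wordRatio_pos hr t).le,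
    dist_eq_norm]

theorem lipschitzWith_Sw (hr : ∀ i, r i ∈ Set.Ioo (0 : ℝ) 1)
    (hS : ∀ i x, S i x = q i + r i • x) (t : List (Fin N)) :
    LipschitzWith (wordRatio r t).toNNReal (Sw S t) :=
  LipschitzWith.of_dist_le' fun x y => (dist_Sw hr hS t x y).le

theorem Sw_surjective (hr : ∀ i, r i ∈ Set.Ioo (0 : ℝ) 1)
    (hS : ∀ i x, S i x = q i + r i • x) (t : List (Fin N)) :
    Function.Surjective (Sw S t) := by
  intro y
  refine ⟨(wordRatio r t)⁻¹ • (y - Sw S t 0), ?_⟩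
  have h := Sw_sub_Sw hS t ((wordRatio r t)⁻¹ • (y - Sw S t 0)) 0
  rw [sub_zero, smul_smul, mul_inv_cancel₀ (wordRatio_pos hr t).ne', one_smul] at h
  exact sub_left_injective h

theorem Sw_append (a b : List (Fin N)) : Sw S (a ++ b) = Sw S a ∘ Sw S b := by
  induction a with
  | nil => rfl
  | cons i a ih => simp [Sw, ih, Function.comp_assoc]

theorem word_length (v : ℕ → Fin N) (k : ℕ) : (word v k).length = k := by
  simp [word]

theorem word_add (v : ℕ → Fin N) (n k : ℕ) :
    word v (n + k) = word v n ++ word (fun i => v (n + i)) k := by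
  simp [word, List.ofFn_add]

theorem wrep_length (w : List (Fin N)) (m : ℕ) : (wrep w m).length = m * w.length := by
  simp [wrep]

theorem wrep_add (w : List (Fin N)) (m k : ℕ) : wrep w (m + k) = wrep w m ++ wrep w k := by
  rw [wrep, List.replicate_add, List.flatten_append, wrep, wrep]

theorem Sw_wrep_fixed {w : List (Fin N)} {x : Euc d} (hx : Sw S w x = x) (m : ℕ) :
    Sw S (wrep w m) x = x := by
  induction m with
  | zero => rfl
  | succ m ih => rw [wrep_add, Sw_append, Function.comp_apply, show wrep w 1 = w by simp [wrep],
      hx, ih]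

variable {C : Set (Euc d)}

theorem Sw_image_subset (hC : C = ⋃ i, S i '' C) (t : List (Fin N)) : Sw S t '' C ⊆ C := by
  induction t with
  | nil => simp [Sw]
  | cons i t ih =>
    rw [Sw, image_comp]
    refine (image_mono ih).trans ?_
    conv_rhs => rw [hC]
    exact subset_iUnion (fun i => S i '' C) i

theorem exists_word_mem_image (hC : C = ⋃ i, S i '' C) (n : ℕ) {x : Euc d} (hx : x ∈ C) :
    ∃ f : Fin n → Fin N, x ∈ Sw S (List.ofFn f) '' C := by
  induction n generalizing x with
  | zero => exact ⟨Fin.elim0, by simpa [Sw] using hx⟩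
  | succ n ih =>
    rw [hC] at hx
    obtain ⟨i, y, hy, rfl⟩ := mem_iUnion.1 hx
    obtain ⟨f, z, hz, rfl⟩ := ih hy
    exact ⟨Fin.cons i f, z, hz, by simp [List.ofFn_succ, Sw]⟩

theorem Sw_image_open_subset {O : Set (Euc d)} (hO : ∀ i, S i '' O ⊆ O) (t : List (Fin N)) :
    Sw S t '' O ⊆ O := by
  induction t with
  | nil => simp [Sw]
  | cons i t ih =>
    rw [Sw, image_comp]
    exact (image_mono ih).trans (hO i)

theorem S_injective (hr : ∀ i, r i ∈ Set.Ioo (0 : ℝ) 1)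
    (hS : ∀ i x, S i x = q i + r i • x) (i : Fin N) : Function.Injective (S i) := by
  intro x y h
  rw [hS, hS] at h
  exact smul_right_injective _ (hr i).1.ne' (add_left_cancel h)

theorem disjoint_Sw_image (hr : ∀ i, r i ∈ Set.Ioo (0 : ℝ) 1)
    (hS : ∀ i x, S i x = q i + r i • x) {O : Set (Euc d)} (hO : ∀ i, S i '' O ⊆ O)
    (hdisj : ∀ i j, i ≠ j → Disjoint (S i '' O) (S j '' O)) :
    ∀ {t u : List (Fin N)}, t.length = u.length → t ≠ u →
      Disjoint (Sw S t '' O) (Sw S u '' O)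
  | [], [], _, h => absurd rfl h
  | i :: t, j :: u, hl, h => by
    rw [Sw, Sw, image_comp, image_comp]
    by_cases hij : i = j
    · subst hij
      have ht : t ≠ u := fun e => h (by rw [e])
      exact (disjoint_image_iff (S_injective hr hS i)).2
        (disjoint_Sw_image hr hS hO hdisj (by simpa using hl) ht)
    · exact (hdisj i j hij).mono (image_mono (Sw_image_open_subset hO t))
        (image_mono (Sw_image_open_subset hO u))

theorem attractor_subset_closure (hr : ∀ i, r i ∈ Set.Ioo (0 : ℝ) 1)
    (hS : ∀ i x, S i x = q i + r i • x) (hCcomp : IsCompact C) (hC : C = ⋃ i, S i '' C)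
    {O : Set (Euc d)} (hOne : O.Nonempty) (hO : ∀ i, S i '' O ⊆ O) : C ⊆ closure O := by
  obtain ⟨a, ha⟩ := hOne
  obtain ⟨ρ, hρ, hρle⟩ := exists_ratio_bound hr
  obtain ⟨R, hR⟩ := hCcomp.isBounded.subset_closedBall a
  intro c hc
  have hR0 : 0 ≤ R := dist_nonneg.trans (mem_closedBall.1 (hR hc))
  rw [Metric.mem_closure_iff]
  intro ε hε
  have hlim : Tendsto (fun n : ℕ => ρ ^ n * R) atTop (𝓝 0) := by
    simpa using (tendsto_pow_atTop_nhds_zero_of_lt_one hρ.1 hρ.2).mul_const R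
  obtain ⟨n, hn⟩ := (hlim.eventually (gt_mem_nhds hε)).exists
  obtain ⟨f, z, hz, rfl⟩ := exists_word_mem_image hC n hc
  refine ⟨Sw S (List.ofFn f) a, Sw_image_open_subset hO _ (mem_image_of_mem _ ha), ?_⟩
  rw [dist_Sw hr hS]
  refine lt_of_le_of_lt ?_ hn
  have h := hρle (List.ofFn f)
  rw [List.length_ofFn] at h
  exact mul_le_mul h (hR hz) dist_nonneg (pow_nonneg hρ.1 n)

/-- Points deep inside the image of the open set under `Sw S t` are separated from the part of the
attractor outside the cylinder of `t`. -/
theorem le_dist_of_notMem_cylinder (hr : ∀ i, r i ∈ Set.Ioo (0 : ℝ) 1)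
    (hS : ∀ i x, S i x = q i + r i • x) (hCcomp : IsCompact C) (hC : C = ⋃ i, S i '' C)
    {O : Set (Euc d)} (hO : ∀ i, S i '' O ⊆ O)
    (hdisj : ∀ i j, i ≠ j → Disjoint (S i '' O) (S j '' O))
    (t : List (Fin N)) {z y : Euc d} {δ : ℝ} (hz : ball z δ ⊆ O) (hδ : 0 < δ)
    (hy : y ∈ C) (hyt : y ∉ Sw S t '' C) :
    wordRatio r t * δ ≤ dist (Sw S t z) y := by
  by_contra! hlt
  have hOne : O.Nonempty := ⟨z, hz (mem_ball_self hδ)⟩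
  have hpos := wordRatio_pos hr t
  obtain ⟨f, b, hb, hfb⟩ := exists_word_mem_image hC t.length hy
  have hne : List.ofFn f ≠ t := by
    rintro h
    exact hyt (h ▸ ⟨b, hb, hfb⟩)
  have hdis := disjoint_Sw_image hr hS hO hdisj (by simp) hne
  have hcl : y ∈ closure (Sw S (List.ofFn f) '' O) := by
    rw [← hfb]
    exact image_closure_subset_closure_image (lipschitzWith_Sw hr hS _).continuous
      (mem_image_of_mem _ (attractor_subset_closure hr hS hCcomp hC hOne hO hb))
  obtain ⟨y', hy'ball, hy'⟩ := mem_closure_iff.1 hcl (ball (Sw S t z) (wordRatio r t * δ))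
    isOpen_ball (by rwa [mem_ball, dist_comm])
  obtain ⟨p, rfl⟩ := Sw_surjective hr hS t y'
  rw [mem_ball, dist_Sw hr hS] at hy'ball
  exact disjoint_left.1 hdis hy'
    (mem_image_of_mem _ (hz (mem_ball.2 (lt_of_mul_lt_mul_left hy'ball hpos.le))))

theorem ediam_Sw_image_le (hr : ∀ i, r i ∈ Set.Ioo (0 : ℝ) 1)
    (hS : ∀ i x, S i x = q i + r i • x) (t : List (Fin N)) (A : Set (Euc d)) :
    ediam (Sw S t '' A) ≤ ENNReal.ofReal (wordRatio r t) * ediam A :=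
  (lipschitzWith_Sw hr hS t).ediam_image_le A

theorem diam_Sw_image_le (hr : ∀ i, r i ∈ Set.Ioo (0 : ℝ) 1)
    (hS : ∀ i x, S i x = q i + r i • x) (t : List (Fin N)) {A : Set (Euc d)}
    (hA : Bornology.IsBounded A) :
    diam (Sw S t '' A) ≤ wordRatio r t * diam A := by
  have h := (lipschitzWith_Sw hr hS t).diam_image_le A hA
  rwa [Real.coe_toNNReal _ (wordRatio_pos hr t).le] at h

theorem sum_wordRatio_rpow (hr : ∀ i, r i ∈ Set.Ioo (0 : ℝ) 1) {s : ℝ}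
    (hdim : ∑ i, r i ^ s = 1) (n : ℕ) :
    ∑ f : Fin n → Fin N, wordRatio r (List.ofFn f) ^ s = 1 := by
  have h := Finset.sum_pow' (Finset.univ) (fun i => r i ^ s) n
  rw [hdim, one_pow, Fintype.piFinset_univ] at h
  rw [h]
  refine Finset.sum_congr rfl fun f _ => ?_
  rw [Real.finsetProd_rpow _ _ fun i _ => (hr _).1.le, wordRatio, List.map_ofFn, List.prod_ofFn]
  rfl

/-- The Hausdorff measure of a self-similar set in its similarity dimension is at most the
Hausdorff content. -/
theorem hausdorffMeasure_le_tsum_cover (hr : ∀ i, r i ∈ Set.Ioo (0 : ℝ) 1)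
    (hS : ∀ i x, S i x = q i + r i • x) (hC : C = ⋃ i, S i '' C)
    {s : ℝ} (hs : 0 < s) (hdim : ∑ i, r i ^ s = 1) {ι : Type*} [Countable ι]
    (V : ι → Set (Euc d)) (hV : C ⊆ ⋃ i, V i) {D : ℝ≥0∞} (hD : D ≠ ⊤)
    (hVD : ∀ i, ediam (V i) ≤ D) :
    μH[s] C ≤ ∑' i, ediam (V i) ^ s := by
  obtain ⟨ρ, hρ, hρle⟩ := exists_ratio_bound hr
  have hlim : Tendsto (fun n : ℕ => ENNReal.ofReal (ρ ^ n) * D) atTop (𝓝 0) := by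
    have h := ENNReal.Tendsto.mul_const (b := D) (ENNReal.tendsto_ofReal
      (tendsto_pow_atTop_nhds_zero_of_lt_one hρ.1 hρ.2)) (Or.inr hD)
    simpa using h
  have key := Measure.hausdorffMeasure_le_liminf_tsum (X := Euc d)
    (ι := fun n : ℕ => (Fin n → Fin N) × ι) s C
    (l := atTop) (fun n : ℕ => ENNReal.ofReal (ρ ^ n) * D) hlim
    (fun n p => Sw S (List.ofFn p.1) '' V p.2)
    (Eventually.of_forall fun n p => (ediam_Sw_image_le hr hS _ _).trans (by
      have h := hρle (List.ofFn p.1)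
      rw [List.length_ofFn] at h
      exact mul_le_mul' (ENNReal.ofReal_le_ofReal h) (hVD p.2)))
    (Eventually.of_forall fun n x hx => by
      obtain ⟨f, z, hz, rfl⟩ := exists_word_mem_image hC n hx
      obtain ⟨i, hi⟩ := mem_iUnion.1 (hV hz)
      exact mem_iUnion.2 ⟨(f, i), mem_image_of_mem _ hi⟩)
  refine key.trans (liminf_le_of_le (by isBoundedDefault) fun b hb => ?_)
  obtain ⟨n, hn⟩ := hb.exists
  refine hn.trans ?_
  have hsum : ∑ f : Fin n → Fin N, ENNReal.ofReal (wordRatio r (List.ofFn f)) ^ s = 1 := by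
    simp_rw [ENNReal.ofReal_rpow_of_pos (wordRatio_pos hr _)]
    rw [← ENNReal.ofReal_sum_of_nonneg fun f _ => Real.rpow_nonneg (wordRatio_pos hr _).le _,
      sum_wordRatio_rpow hr hdim, ENNReal.ofReal_one]
  calc ∑' p : (Fin n → Fin N) × ι, ediam (Sw S (List.ofFn p.1) '' V p.2) ^ s
      ≤ ∑' p : (Fin n → Fin N) × ι,
          ENNReal.ofReal (wordRatio r (List.ofFn p.1)) ^ s * ediam (V p.2) ^ s := by
        refine ENNReal.tsum_le_tsum fun p => ?_
        rw [← ENNReal.mul_rpow_of_nonneg _ _ hs.le]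
        exact ENNReal.rpow_le_rpow (ediam_Sw_image_le hr hS _ _) hs.le
    _ = ∑' i, ediam (V i) ^ s := by
        rw [ENNReal.tsum_prod', tsum_fintype]
        simp_rw [ENNReal.tsum_mul_left]
        rw [← Finset.sum_mul, hsum, one_mul]

theorem hausdorffMeasure_inter_le_ediam (hr : ∀ i, r i ∈ Set.Ioo (0 : ℝ) 1)
    (hS : ∀ i x, S i x = q i + r i • x) (hC : C = ⋃ i, S i '' C)
    {s : ℝ} (hs : 0 < s) (hdim : ∑ i, r i ^ s = 1) (hfin : μH[s] C ≠ ⊤)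
    {B : Set (Euc d)} (hB : MeasurableSet B) :
    μH[s] (C ∩ B) ≤ ediam B ^ s := by
  by_cases hBtop : ediam B = ⊤
  · simp [hBtop, hs]
  have hdiff : μH[s] (C \ B) ≠ ⊤ := ne_top_of_le_ne_top hfin (measure_mono sdiff_subset)
  suffices h : μH[s] C ≤ ediam B ^ s + μH[s] (C \ B) by
    rw [← measure_inter_add_sdiff C hB] at h
    exact (ENNReal.add_le_add_iff_right hdiff).1 h
  refine ENNReal.le_of_forall_pos_le_add fun ε hε _ => ?_
  have hlt : μH[s] (C \ B) < μH[s] (C \ B) + ε :=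
    ENNReal.lt_add_right hdiff (by exact_mod_cast hε.ne')
  have hle := (Measure.hausdorffMeasure_apply s (C \ B)).ge
  have hinf := ((le_iSup₂ (f := fun (r : ℝ≥0∞) (_ : 0 < r) =>
    ⨅ (t : ℕ → Set (Euc d)) (_ : C \ B ⊆ ⋃ n, t n) (_ : ∀ n, ediam (t n) ≤ r),
      ∑' n, ⨆ _ : (t n).Nonempty, ediam (t n) ^ s) 1 one_pos).trans hle).trans_lt hlt
  simp only [iInf_lt_iff] at hinf
  obtain ⟨t, htC, ht1, hsum⟩ := hinf
  have hcov := hausdorffMeasure_le_tsum_cover hr hS hC hs hdim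
    (fun n : ℕ => n.casesOn B t)
    (fun x hx => by
      by_cases hxB : x ∈ B
      · exact mem_iUnion.2 ⟨0, hxB⟩
      · obtain ⟨n, hn⟩ := mem_iUnion.1 (htC ⟨hx, hxB⟩)
        exact mem_iUnion.2 ⟨n + 1, hn⟩)
    (D := max (ediam B) 1) (by simp [hBtop])
    (fun n => by
      cases n with
      | zero => exact le_max_left _ _
      | succ n => exact (ht1 n).trans (le_max_right _ _))
  refine hcov.trans ?_
  rw [tsum_eq_zero_add' ENNReal.summable, add_assoc]
  refine add_le_add le_rfl (le_trans (ENNReal.tsum_le_tsum fun n => ?_) hsum.le)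
  rcases (t n).eq_empty_or_nonempty with he | hne
  · simp [he, hs]
  · simp [hne]

/-- Deep cylinders of the periodic word `www…` lie uniformly inside the open set. -/
theorem exists_ball_subset_of_wrep (hr : ∀ i, r i ∈ Set.Ioo (0 : ℝ) 1)
    (hS : ∀ i x, S i x = q i + r i • x) (hCcomp : IsCompact C)
    {O : Set (Euc d)} (hOop : IsOpen O) {w : List (Fin N)} (hwne : w ≠ []) {xw : Euc d}
    (hxw : Sw S w xw = xw) (hxwO : xw ∈ O) :
    ∃ (δ : ℝ) (n₀ : ℕ), 0 < δ ∧
      ∀ k, n₀ ≤ k → ∀ z ∈ Sw S (wrep w k) '' C, ball z δ ⊆ O := by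
  obtain ⟨ε, hε, hεO⟩ := Metric.isOpen_iff.1 hOop xw hxwO
  obtain ⟨ρ, hρ, hρle⟩ := exists_ratio_bound hr
  obtain ⟨R, hR⟩ := hCcomp.isBounded.subset_closedBall xw
  have hlim : Tendsto (fun n : ℕ => ρ ^ n * R) atTop (𝓝 0) := by
    simpa using (tendsto_pow_atTop_nhds_zero_of_lt_one hρ.1 hρ.2).mul_const R
  obtain ⟨n₀, hn₀⟩ := eventually_atTop.1 (hlim.eventually (gt_mem_nhds (half_pos hε)))
  refine ⟨ε / 2, n₀, half_pos hε, ?_⟩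
  rintro k hk _ ⟨c, hc, rfl⟩
  have hlen : k ≤ (wrep w k).length := by
    rw [wrep_length]
    exact Nat.le_mul_of_pos_right k (List.length_pos_iff.2 hwne)
  have hlt : dist (Sw S (wrep w k) c) xw < ε / 2 := by
    conv_lhs => rw [← Sw_wrep_fixed hxw k]
    rw [dist_Sw hr hS]
    exact (mul_le_mul (hρle _) (hR hc) dist_nonneg (pow_nonneg hρ.1 _)).trans_lt
      (hn₀ _ (hk.trans hlen))
  refine fun y hy => hεO ?_
  have := dist_triangle y (Sw S (wrep w k) c) xw
  rw [mem_ball] at hy ⊢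
  linarith

end SelfSimilar

theorem exists_bound_of_homogeneous {d : ℕ} {Ω : Euc d → ℝ} (hΩc : ContinuousOn Ω {x | x ≠ 0})
    (hΩhom : ∀ c : ℝ, 0 < c → ∀ x, x ≠ 0 → Ω (c • x) = Ω x) :
    ∃ M, 0 ≤ M ∧ ∀ x, x ≠ 0 → |Ω x| ≤ M := by
  obtain ⟨M, hM⟩ := (isCompact_sphere (0 : Euc d) 1).exists_bound_of_continuousOn
    (hΩc.mono fun x hx => ne_zero_of_mem_unit_sphere ⟨x, hx⟩)
  refine ⟨max M 0, le_max_right _ _, fun x hx => ?_⟩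
  rw [← hΩhom ‖x‖⁻¹ (by positivity) x hx]
  refine (hM _ ?_).trans (le_max_left _ _)
  rw [mem_sphere_zero_iff_norm, norm_smul, norm_inv, norm_norm,
    inv_mul_cancel₀ (norm_ne_zero_iff.2 hx)]

theorem abs_kernel_le {d : ℕ} {Ω : Euc d → ℝ} {M : ℝ} (hM : ∀ x, x ≠ 0 → |Ω x| ≤ M)
    {s : ℝ} (hs : 0 < s) {x y : Euc d} {ε : ℝ} (hε : 0 < ε) (hxy : ε ≤ dist x y) :
    ‖Ω (x - y) / ‖x - y‖ ^ s‖ ≤ M / ε ^ s := by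
  rw [dist_eq_norm] at hxy
  have hne : x - y ≠ 0 := norm_pos_iff.1 (hε.trans_le hxy)
  have hM' := hM _ hne
  rw [norm_div, Real.norm_of_nonneg (Real.rpow_nonneg (norm_nonneg _) s), Real.norm_eq_abs]
  exact div_le_div₀ ((abs_nonneg _).trans hM') hM' (Real.rpow_pos_of_pos hε s)
    (Real.rpow_le_rpow hε.le hxy hs.le)

theorem measurable_kernel {d : ℕ} {Ω : Euc d → ℝ} (hΩc : ContinuousOn Ω {x | x ≠ 0}) (s : ℝ)
    (x : Euc d) : Measurable fun y => Ω (x - y) / ‖x - y‖ ^ s := by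
  have hΩ : Measurable Ω := measurable_of_continuousOn_compl_singleton 0 hΩc
  exact (hΩ.comp (measurable_const.sub measurable_id)).div
    ((measurable_const.sub measurable_id).norm.pow_const s)

theorem abs_setIntegral_sub_setIntegral_le {X : Type*} [MeasurableSpace X] {μ : Measure X}
    {A B : Set X} (hA : MeasurableSet A) (hB : MeasurableSet B) {g : X → ℝ}
    (hgA : IntegrableOn g A μ) (hgB : IntegrableOn g B μ) :
    |(∫ x in A, g x ∂μ) - ∫ x in B, g x ∂μ| ≤
      |∫ x in A \ B, g x ∂μ| + |∫ x in B \ A, g x ∂μ| := by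
  rw [← integral_inter_add_sdiff hB hgA, ← integral_inter_add_sdiff hA hgB, inter_comm B A,
    add_sub_add_left_eq_sub]
  exact abs_sub _ _

/-- A measure bounded by a multiple of `diam ^ s` integrates a kernel of size `dist ^ (-s)` over
an annular region of bounded modulus to a bounded quantity. -/
theorem abs_setIntegral_kernel_le {d : ℕ} {Ω : Euc d → ℝ} {M : ℝ} (hM0 : 0 ≤ M)
    (hM : ∀ x, x ≠ 0 → |Ω x| ≤ M) {s : ℝ} (hs : 0 < s) {μ : Measure (Euc d)} {C : Set (Euc d)}
    (hμC : ∀ᵐ y ∂μ, y ∈ C) {h : ℝ≥0∞} (hh : h ≠ ⊤)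
    (hμ : ∀ B, MeasurableSet B → μ B ≤ h * ediam B ^ s) {D δ ρ : ℝ} (hD : 0 ≤ D) (hδ : 0 < δ)
    (hρ : 0 < ρ) {x : Euc d} {T : Set (Euc d)} (hT : T ⊆ closedBall x (2 * (ρ * D)))
    (hTC : ∀ y ∈ T, y ∈ C → ρ * δ ≤ dist x y) :
    |∫ y in T, Ω (x - y) / ‖x - y‖ ^ s ∂μ| ≤ M * h.toReal * (4 * D / δ) ^ s := by
  have hed : ediam (closedBall x (2 * (ρ * D))) ≤ ENNReal.ofReal (ρ * (4 * D)) := by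
    refine ediam_le_of_forall_dist_le fun y hy z hz => ?_
    have := dist_triangle_right y z x
    rw [mem_closedBall] at hy hz
    linarith
  have hle : μ T ≤ h * ENNReal.ofReal ((ρ * (4 * D)) ^ s) := by
    refine (measure_mono hT).trans ((hμ _ measurableSet_closedBall).trans ?_)
    rw [← ENNReal.ofReal_rpow_of_nonneg (by positivity) hs.le]
    gcongr
  have hfin : h * ENNReal.ofReal ((ρ * (4 * D)) ^ s) ≠ ⊤ :=
    ENNReal.mul_ne_top hh ENNReal.ofReal_ne_top
  have hreal : μ.real T ≤ h.toReal * (ρ * (4 * D)) ^ s := by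
    refine (ENNReal.toReal_mono hfin hle).trans_eq ?_
    rw [ENNReal.toReal_mul, ENNReal.toReal_ofReal (by positivity)]
  have hρδ : 0 < ρ * δ := mul_pos hρ hδ
  calc |∫ y in T, Ω (x - y) / ‖x - y‖ ^ s ∂μ| ≤ M / (ρ * δ) ^ s * μ.real T :=
        norm_setIntegral_le_of_norm_le_const_ae' (hle.trans_lt hfin.lt_top) (by
          filter_upwards [hμC] with y hy hyT
          exact abs_kernel_le hM hs hρδ (hTC y hyT hy))
    _ ≤ M / (ρ * δ) ^ s * (h.toReal * (ρ * (4 * D)) ^ s) := by gcongr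
    _ = M * h.toReal * (4 * D / δ) ^ s := by
        rw [Real.mul_rpow hρ.le hδ.le, Real.mul_rpow hρ.le (by positivity),
          Real.div_rpow (by positivity) hδ.le]
        have := (Real.rpow_pos_of_pos hρ s).ne'
        field_simp

theorem integrableOn_kernel {d : ℕ} {Ω : Euc d → ℝ} (hΩc : ContinuousOn Ω {x | x ≠ 0}) {M : ℝ}
    (hM : ∀ x, x ≠ 0 → |Ω x| ≤ M) {s : ℝ} (hs : 0 < s) {μ : Measure (Euc d)}
    [IsFiniteMeasure μ] {C : Set (Euc d)} (hμC : ∀ᵐ y ∂μ, y ∈ C) {ε : ℝ} (hε : 0 < ε)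
    {x : Euc d} {T : Set (Euc d)} (hT : MeasurableSet T)
    (hTC : ∀ y ∈ T, y ∈ C → ε ≤ dist x y) :
    IntegrableOn (fun y => Ω (x - y) / ‖x - y‖ ^ s) T μ := by
  refine Measure.integrableOn_of_bounded (M := M / ε ^ s) (measure_ne_top _ _)
    (measurable_kernel hΩc s x).aestronglyMeasurable ?_
  rw [ae_restrict_iff' hT]
  filter_upwards [hμC] with y hy hyT
  exact abs_kernel_le hM hs hε (hTC y hyT hy)

/-- Truncations along nested cylinders are comparable to truncations along the corresponding
balls if the center is well separated from the rest of the attractor at both scales. -/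
theorem abs_cylinder_sub_ball_le {d : ℕ} {Ω : Euc d → ℝ} (hΩc : ContinuousOn Ω {x | x ≠ 0})
    {M : ℝ} (hM0 : 0 ≤ M) (hM : ∀ x, x ≠ 0 → |Ω x| ≤ M) {s : ℝ} (hs : 0 < s)
    {μ : Measure (Euc d)} [IsFiniteMeasure μ] {C : Set (Euc d)} (hμC : ∀ᵐ y ∂μ, y ∈ C)
    {h : ℝ≥0∞} (hh : h ≠ ⊤) (hμ : ∀ B, MeasurableSet B → μ B ≤ h * ediam B ^ s)
    {D δ ρ₁ ρ₂ : ℝ} (hD : 0 ≤ D) (hδ : 0 < δ) (hρ₁ : 0 < ρ₁) (hρ₂ : 0 < ρ₂)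
    {x : Euc d} {A₁ A₂ : Set (Euc d)} (hA₁ : IsCompact A₁) (hA₂ : IsCompact A₂)
    (hx₁ : x ∈ A₁) (hx₂ : x ∈ A₂)
    (hdiam₁ : diam A₁ ≤ ρ₁ * D) (hdiam₂ : diam A₂ ≤ ρ₂ * D)
    (hsep₁ : ∀ y ∈ C, y ∉ A₁ → ρ₁ * δ ≤ dist x y)
    (hsep₂ : ∀ y ∈ C, y ∉ A₂ → ρ₂ * δ ≤ dist x y) :
    |(∫ y in A₁ \ A₂, Ω (x - y) / ‖x - y‖ ^ s ∂μ) -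
      ∫ y in closedBall x (2 * diam A₁) \ closedBall x (2 * diam A₂),
        Ω (x - y) / ‖x - y‖ ^ s ∂μ| ≤
      2 * (M * h.toReal * (4 * D / δ) ^ s) := by
  have hsub : ∀ {A : Set (Euc d)}, IsCompact A → x ∈ A → A ⊆ closedBall x (2 * diam A) := by
    intro A hA hx y hy
    have h1 := dist_le_diam_of_mem hA.isBounded hy hx
    have h2 : 0 ≤ diam A := diam_nonneg
    rw [mem_closedBall]
    linarith
  have hmA : MeasurableSet (A₁ \ A₂) := hA₁.measurableSet.diff hA₂.measurableSet
  have hmB : MeasurableSet (closedBall x (2 * diam A₁) \ closedBall x (2 * diam A₂)) :=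
    measurableSet_closedBall.diff measurableSet_closedBall
  have hε : 0 < ρ₂ * δ := mul_pos hρ₂ hδ
  refine (abs_setIntegral_sub_setIntegral_le hmA hmB
    (integrableOn_kernel hΩc hM hs hμC hε hmA fun y hy hyC => hsep₂ y hyC hy.2)
    (integrableOn_kernel hΩc hM hs hμC hε hmB fun y hy hyC =>
      hsep₂ y hyC fun hyA => hy.2 (hsub hA₂ hx₂ hyA))).trans ?_
  rw [two_mul (M * _ * _)]
  refine add_le_add ?_ ?_
  · refine abs_setIntegral_kernel_le hM0 hM hs hμC hh hμ hD hδ hρ₂ (fun y hy => ?_)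
      fun y hy hyC => hsep₂ y hyC hy.1.2
    refine closedBall_subset_closedBall (mul_le_mul_of_nonneg_left hdiam₂ zero_le_two) ?_
    by_contra hyB
    exact hy.2 ⟨hsub hA₁ hx₁ hy.1.1, hyB⟩
  · refine abs_setIntegral_kernel_le hM0 hM hs hμC hh hμ hD hδ hρ₁ (fun y hy => ?_)
      fun y hy hyC => hsep₁ y hyC fun hyA =>
        hy.2 ⟨hyA, fun hyA₂ => hy.1.2 (hsub hA₂ hx₂ hyA₂)⟩
    exact closedBall_subset_closedBall (mul_le_mul_of_nonneg_left hdiam₁ zero_le_two) hy.1.1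

/-- (Comparison lemma.) Under the SOSC with `x_w ∈ O`, truncations of the
singular integral along cylinders are uniformly comparable to truncations along balls. -/
theorem stmt6
    {d N : ℕ} (hd : 1 ≤ d) (hN : 2 ≤ N)
    (q : Fin N → Euc d) (r : Fin N → ℝ) (hr : ∀ i, r i ∈ Set.Ioo (0:ℝ) 1)
    (S : Fin N → Euc d → Euc d) (hS : ∀ i x, S i x = q i + r i • x)
    (C : Set (Euc d)) (hCne : C.Nonempty) (hCcomp : IsCompact C)
    (hCinv : C = ⋃ i, S i '' C)
    (O : Set (Euc d)) (hOop : IsOpen O) (hOne : O.Nonempty)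
    (hOsub : ∀ i, S i '' O ⊆ O)
    (hOdisj : ∀ i j, i ≠ j → Disjoint (S i '' O) (S j '' O))
    (hSOSC : (O ∩ C).Nonempty)
    (s : ℝ) (hs : 0 < s) (hdim : ∑ i, r i ^ s = 1)
    (μ : Measure (Euc d)) (hμ : μ = (μH[s] C)⁻¹ • μH[s].restrict C)
    (π : (ℕ → Fin N) → Euc d)
    (hπ : ∀ w, (⋂ k, Sw S (word w k) '' C) = {π w})
    (Ω : Euc d → ℝ)
    (hΩc : ContinuousOn Ω {x | x ≠ 0})
    (hΩne : ∃ x, x ≠ 0 ∧ Ω x ≠ 0)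
    (hΩhom : ∀ c : ℝ, 0 < c → ∀ x, x ≠ 0 → Ω (c • x) = Ω x)
    (w : List (Fin N)) (hwne : w ≠ []) (xw : Euc d) (hxw : Sw S w xw = xw)
    (hxwO : xw ∈ O) :
    ∃ (n₀ : ℕ) (c₁ : ℝ), 0 < c₁ ∧
      ∀ (v : ℕ → Fin N) (n m : ℕ), 1 ≤ m →
        word (fun i => v (n + i)) (wrep w (m + n₀)).length = wrep w (m + n₀) →
        |(∫ y in Sw S (word v n) '' C \ Sw S (word v (n + m * w.length)) '' C,
            Ω (π v - y) / ‖π v - y‖ ^ s ∂μ) -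
         (∫ y in closedBall (π v) (2 * diam (Sw S (word v n) '' C)) \
              closedBall (π v) (2 * diam (Sw S (word v (n + m * w.length)) '' C)),
            Ω (π v - y) / ‖π v - y‖ ^ s ∂μ)| ≤ c₁ := by
  obtain ⟨δ, n₀, hδ, hδO⟩ := exists_ball_subset_of_wrep hr hS hCcomp hOop hwne hxw hxwO
  by_cases h0 : μH[s] C = 0 ∨ μH[s] C = ⊤
  · have hμ0 : μ = 0 := by
      rcases h0 with h0 | h0
      · rw [hμ, Measure.restrict_eq_zero.2 h0, smul_zero]
      · rw [hμ, h0, ENNReal.inv_top, zero_smul]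
    exact ⟨0, 1, one_pos, fun v n m _ _ => by simp [hμ0]⟩
  push Not at h0
  obtain ⟨h0, htop⟩ := h0
  have hinv : (μH[s] C)⁻¹ ≠ ⊤ := ENNReal.inv_ne_top.2 h0
  have hμC : ∀ᵐ y ∂μ, y ∈ C := by
    rw [hμ]
    exact Measure.ae_smul_measure (ae_restrict_mem hCcomp.measurableSet) _
  have : IsFiniteMeasure μ := ⟨by
    rw [hμ, Measure.smul_apply, Measure.restrict_apply_univ, smul_eq_mul]
    exact ENNReal.mul_lt_top hinv.lt_top htop.lt_top⟩
  have hμB : ∀ B, MeasurableSet B → μ B ≤ (μH[s] C)⁻¹ * ediam B ^ s := by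
    intro B hB
    rw [hμ, Measure.smul_apply, Measure.restrict_apply hB, smul_eq_mul, inter_comm]
    gcongr
    exact hausdorffMeasure_inter_le_ediam hr hS hCinv hs hdim htop hB
  obtain ⟨M, hM0, hM⟩ := exists_bound_of_homogeneous hΩc hΩhom
  have hc : 0 ≤ M * (μH[s] C)⁻¹.toReal * (4 * diam C / δ) ^ s := by
    have : 0 ≤ diam C := diam_nonneg
    positivity
  refine ⟨n₀, 2 * (M * (μH[s] C)⁻¹.toReal * (4 * diam C / δ) ^ s) + 1, by linarith, ?_⟩
  intro v n m _ hv
  have hmem : ∀ k, π v ∈ Sw S (word v k) '' C := fun k =>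
    mem_iInter.1 ((hπ v).symm ▸ mem_singleton (π v)) k
  have hlen : (wrep w (m + n₀)).length = m * w.length + n₀ * w.length := by
    rw [wrep_length, add_mul]
  have hprefix : word (fun i => v (n + i)) (m * w.length) = wrep w m := by
    rw [hlen, word_add, wrep_add] at hv
    exact (List.append_inj hv (by rw [word_length, wrep_length])).1
  have hx : π v ∈ Sw S (word v n ++ (wrep w m ++ wrep w n₀)) '' C := by
    rw [← wrep_add, ← hv, ← word_add]
    exact hmem _
  have hsep : ∀ t k, n₀ ≤ k → π v ∈ Sw S (t ++ wrep w k) '' C →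
      ∀ y ∈ C, y ∉ Sw S t '' C → wordRatio r t * δ ≤ dist (π v) y := by
    intro t k hk hxt y hy hyt
    rw [Sw_append, image_comp] at hxt
    obtain ⟨z, hz, hzx⟩ := hxt
    rw [← hzx]
    exact le_dist_of_notMem_cylinder hr hS hCcomp hCinv hOsub hOdisj t (hδO k hk z hz) hδ hy hyt
  have hcomp : ∀ t, IsCompact (Sw S t '' C) := fun t =>
    hCcomp.image (lipschitzWith_Sw hr hS t).continuous
  have hword : word v (n + m * w.length) = word v n ++ wrep w m := by
    rw [word_add, hprefix]
  refine (abs_cylinder_sub_ball_le hΩc hM0 hM hs hμC hinv hμB diam_nonneg hδ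
    (wordRatio_pos hr (word v n)) (wordRatio_pos hr (word v (n + m * w.length)))
    (hcomp _) (hcomp _) (hmem _) (hmem _)
    (diam_Sw_image_le hr hS _ hCcomp.isBounded) (diam_Sw_image_le hr hS _ hCcomp.isBounded)
    (hsep _ (m + n₀) (by omega) (by rwa [wrep_add]))
    (hsep _ n₀ le_rfl (by rwa [hword, List.append_assoc]))).trans (by linarith)
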